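/- Let k ≥ 1 be a fixed integer, p(n) = (log n + (k+1)·log log n − log log log n)/n, D = log n / log log n and ε = ε(n) = 1/log log n. Then almost surely, for every pair of large vertices u and v of G = G(n, p(n)), there exists a subgraph G_{u,v} of G consisting of two vertex-disjoint rooted trees T_u and T_v, rooted at u and v respectively, each of depth ⌊(3/4 − ε)·D⌋, in which every non-leaf vertex has exactly ⌊(log n)/101⌋ children. -/

import Mathlib

open Filter Asymptotics
open scoped Classical

noncomputable section

/-- The number of edges of a simple graph on a finite vertex type. -/
def edgeCount {V : Type*} [Fintype V] (G : SimpleGraph V) : ℕ :=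
  G.edgeFinset.card

/-- Probability in the Erdős–Rényi model `G(n,p)` of a set `A` of graphs on `Fin n`:
each of the `n.choose 2` possible edges is present independently with probability `p`. -/
def gnpProb (n : ℕ) (p : ℝ) (A : Set (SimpleGraph (Fin n))) : ℝ :=
  ∑ G ∈ Finset.univ.filter (fun G => G ∈ A),
    p ^ edgeCount G * (1 - p) ^ (n.choose 2 - edgeCount G)

/-- Probability in the uniform model `G(n,M)` of a set `A` of graphs on `Fin n`:
all graphs with exactly `M` edges are equally likely. -/
def gnmProb (n M : ℕ) (A : Set (SimpleGraph (Fin n))) : ℝ :=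
  ((Finset.univ.filter (fun G : SimpleGraph (Fin n) => edgeCount G = M ∧ G ∈ A)).card : ℝ) /
    ((Finset.univ.filter (fun G : SimpleGraph (Fin n) => edgeCount G = M)).card : ℝ)

/-- `κ(S)`: the largest number of internally disjoint trees connecting `S`, i.e. trees
`T₁, …, T_k` of `G` with `S ⊆ V(Tᵢ)`, `V(Tᵢ) ∩ V(Tⱼ) = S` and `E(Tᵢ) ∩ E(Tⱼ) = ∅`
for `i ≠ j`. -/
def kappaSet {V : Type*} (G : SimpleGraph V) (S : Set V) : ℕ :=
  sSup {k | ∃ T : Fin k → G.Subgraph,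
    (∀ i, S ⊆ (T i).verts ∧ ((T i).coe).IsTree) ∧
    (∀ i j, i ≠ j → (T i).verts ∩ (T j).verts = S ∧
      (T i).edgeSet ∩ (T j).edgeSet = ∅)}

/-- `λ(S)`: the largest number of pairwise edge-disjoint trees of `G` each containing `S`. -/
def lambdaSet {V : Type*} (G : SimpleGraph V) (S : Set V) : ℕ :=
  sSup {k | ∃ T : Fin k → G.Subgraph,
    (∀ i, S ⊆ (T i).verts ∧ ((T i).coe).IsTree) ∧
    (∀ i j, i ≠ j → (T i).edgeSet ∩ (T j).edgeSet = ∅)}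

/-- The generalized `r`-connectivity `κ_r(G)`: the minimum of `κ(S)` over `r`-subsets `S`,
and `0` if `G` is disconnected. -/
def genKappa {V : Type*} [Fintype V] (r : ℕ) (G : SimpleGraph V) : ℕ :=
  if G.Connected then
    sInf {k | ∃ S : Finset V, S.card = r ∧ kappaSet G ↑S = k}
  else 0

/-- The generalized `r`-edge-connectivity `λ_r(G)`: the minimum of `λ(S)` over
`r`-subsets `S`, and `0` if `G` is disconnected. -/
def genLambda {V : Type*} [Fintype V] (r : ℕ) (G : SimpleGraph V) : ℕ :=
  if G.Connected then
    sInf {k | ∃ S : Finset V, S.card = r ∧ lambdaSet G ↑S = k}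
  else 0

/-- The vertex connectivity `κ(G)`: the largest `k` such that `G` is `k`-connected,
i.e. `k < |V|` and the removal of fewer than `k` vertices leaves a connected graph. -/
def vertexConnectivity {V : Type*} [Fintype V] (G : SimpleGraph V) : ℕ :=
  sSup {k | k < Fintype.card V ∧
    ∀ S : Finset V, S.card < k → (G.induce ((↑S : Set V)ᶜ)).Connected}

/-- The edge connectivity `λ(G)`: the largest `k` such that removing fewer than `k`
edges always leaves a connected graph. -/
def edgeConnectivity {V : Type*} [Fintype V] (G : SimpleGraph V) : ℕ :=
  sSup {k | ∀ F : Finset (Sym2 V), F.card < k → (G.deleteEdges ↑F).Connected}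

/-- The minimum degree `δ(G)`. -/
def minDeg {V : Type*} [Fintype V] (G : SimpleGraph V) : ℕ :=
  G.minDegree

/-- The number of children of `v` in the graph `H` viewed as rooted at `r`:
neighbours of `v` lying one step further from the root. -/
def childCount {W : Type*} (H : SimpleGraph W) (r v : W) : ℕ :=
  {w | H.Adj v w ∧ H.dist r w = H.dist r v + 1}.ncard

/-- The depth of the graph `H` viewed as rooted at `r`: the largest distance from `r`. -/
def rootedDepth {W : Type*} (H : SimpleGraph W) (r : W) : ℕ :=
  sSup (Set.range (H.dist r))

/-- `T` is a subtree of `G` rooted at `r`, of depth `d`, in which every non-leaf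
vertex has exactly `t` children (a `t`-ary tree of depth `d`). -/
def IsAryTreeOfDepth {V : Type*} {G : SimpleGraph V} (T : G.Subgraph) (r : V)
    (t d : ℕ) : Prop :=
  ∃ hr : r ∈ T.verts,
    T.coe.IsTree ∧ rootedDepth T.coe ⟨r, hr⟩ = d ∧
      ∀ v : T.verts, childCount T.coe ⟨r, hr⟩ v = 0 ∨ childCount T.coe ⟨r, hr⟩ v = t

end

/-- The weight of a graph in `G(n,p)`. -/
noncomputable def gnpWeight (n : ℕ) (p : ℝ) (G : SimpleGraph (Fin n)) : ℝ :=
  p ^ edgeCount G * (1 - p) ^ (n.choose 2 - edgeCount G)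

lemma gnpWeight_nonneg {n : ℕ} {p : ℝ} (h0 : 0 ≤ p) (h1 : p ≤ 1) (G : SimpleGraph (Fin n)) :
    0 ≤ gnpWeight n p G :=
  mul_nonneg (pow_nonneg h0 _) (pow_nonneg (by linarith) _)

lemma gnpProb_eq_sum_ite (n : ℕ) (p : ℝ) (A : Set (SimpleGraph (Fin n))) :
    gnpProb n p A = ∑ G, gnpWeight n p G * (if G ∈ A then 1 else 0) := by
  unfold gnpProb gnpWeight
  rw [Finset.sum_filter]
  exact Finset.sum_congr rfl fun G _ => by split_ifs <;> simp

/-- Summing over all graphs is summing over all sets of non-loop edges. -/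
lemma sum_gnpWeight_eq (n : ℕ) (p : ℝ) (φ : Finset (Sym2 (Fin n)) → ℝ) :
    ∑ G : SimpleGraph (Fin n), gnpWeight n p G * φ G.edgeFinset =
      ∑ s ∈ ((⊤ : SimpleGraph (Fin n)).edgeFinset).powerset,
        p ^ s.card * (1 - p) ^ ((⊤ : SimpleGraph (Fin n)).edgeFinset \ s).card * φ s := by
  have hU : (⊤ : SimpleGraph (Fin n)).edgeFinset.card = n.choose 2 := by
    have := SimpleGraph.card_edgeFinset_top_eq_card_choose_two (V := Fin n)
    simpa using this
  refine Finset.sum_bij' (fun G _ => G.edgeFinset)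
    (fun s _ => SimpleGraph.fromEdgeSet (s : Set (Sym2 (Fin n)))) ?_ ?_ ?_ ?_ ?_
  · intro G _
    rw [Finset.mem_powerset]
    exact SimpleGraph.edgeFinset_mono le_top
  · intro s _
    exact Finset.mem_univ _
  · intro G _
    simp
  · intro s hs
    ext e
    have := fun h : e ∈ s => Finset.mem_powerset.mp hs h
    simp only [SimpleGraph.mem_edgeFinset, SimpleGraph.edgeSet_fromEdgeSet, Set.mem_sdiff,
      Finset.mem_coe] at this ⊢
    constructor
    · exact fun h => h.1
    · intro h
      refine ⟨h, ?_⟩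
      have h2 := this h
      simpa [SimpleGraph.edgeSet_top] using h2
  · intro G _
    have hsub : G.edgeFinset ⊆ (⊤ : SimpleGraph (Fin n)).edgeFinset :=
      SimpleGraph.edgeFinset_mono le_top
    rw [Finset.card_sdiff_of_subset hsub, hU]
    rfl

/-- Exponential moment of the number of edges in `B`, on the event that all of `F` is present. -/
lemma sum_gnpWeight_subset_mul_pow (n : ℕ) (p c : ℝ) (F B : Finset (Sym2 (Fin n)))
    (hF : F ⊆ (⊤ : SimpleGraph (Fin n)).edgeFinset)
    (hB : B ⊆ (⊤ : SimpleGraph (Fin n)).edgeFinset) (hFB : Disjoint F B) :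
    ∑ G : SimpleGraph (Fin n), gnpWeight n p G *
      ((if F ⊆ G.edgeFinset then 1 else 0) * c ^ (G.edgeFinset ∩ B).card) =
      p ^ F.card * (1 - p + c * p) ^ B.card := by
  rw [sum_gnpWeight_eq n p (fun s => (if F ⊆ s then 1 else 0) * c ^ (s ∩ B).card)]
  set U := (⊤ : SimpleGraph (Fin n)).edgeFinset
  have key := Finset.prod_add (fun e => p * (if e ∈ B then c else 1))
    (fun e => (1 - p) * (if e ∈ F then 0 else 1)) U
  have hterm : ∀ s ∈ U.powerset,
      (∏ e ∈ s, p * (if e ∈ B then c else 1)) *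
        (∏ e ∈ U \ s, (1 - p) * (if e ∈ F then (0 : ℝ) else 1)) =
      p ^ s.card * (1 - p) ^ (U \ s).card *
        ((if F ⊆ s then 1 else 0) * c ^ (s ∩ B).card) := by
    intro s hs
    rw [Finset.prod_mul_distrib, Finset.prod_mul_distrib, Finset.prod_const, Finset.prod_const,
      Finset.prod_ite_mem, Finset.prod_const]
    have : ∏ e ∈ U \ s, (if e ∈ F then (0 : ℝ) else 1) = if F ⊆ s then 1 else 0 := by
      split_ifs with h
      · refine Finset.prod_eq_one fun e he => ?_
        rw [if_neg]
        exact fun hf => (Finset.mem_sdiff.mp he).2 (h hf)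
      · obtain ⟨e, he, hes⟩ := Finset.not_subset.mp h
        exact Finset.prod_eq_zero (Finset.mem_sdiff.mpr ⟨hF he, hes⟩) (by simp [he])
    rw [this]
    ring
  rw [← Finset.sum_congr rfl hterm, ← key]
  have hprod : ∀ e ∈ U, p * (if e ∈ B then c else 1) + (1 - p) * (if e ∈ F then 0 else 1) =
      (if e ∈ F then p else 1) * (if e ∈ B then (1 - p + c * p) else 1) := by
    intro e _
    by_cases h1 : e ∈ F
    · have h2 : e ∉ B := Finset.disjoint_left.mp hFB h1
      simp [h1, h2]
    · by_cases h2 : e ∈ B <;> simp [h1, h2]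
      ring
  rw [Finset.prod_congr rfl hprod, Finset.prod_mul_distrib, Finset.prod_ite_mem,
    Finset.prod_ite_mem, Finset.prod_const, Finset.prod_const,
    Finset.inter_eq_right.mpr hF, Finset.inter_eq_right.mpr hB]

lemma sum_gnpWeight (n : ℕ) (p : ℝ) : ∑ G : SimpleGraph (Fin n), gnpWeight n p G = 1 := by
  simpa using sum_gnpWeight_subset_mul_pow n p 1 ∅ ∅ (by simp) (by simp) (by simp)

lemma gnpProb_le_one {n : ℕ} {p : ℝ} (h0 : 0 ≤ p) (h1 : p ≤ 1) (A : Set (SimpleGraph (Fin n))) :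
    gnpProb n p A ≤ 1 := by
  rw [gnpProb_eq_sum_ite]
  refine le_trans ?_ (sum_gnpWeight n p).le
  refine Finset.sum_le_sum fun G _ => ?_
  have := gnpWeight_nonneg h0 h1 G
  split_ifs <;> simp [this]

/-- If `A` contains every graph having both properties `P` and `Q`, the failure probabilities of
`P` and `Q` bound that of `A`. -/
lemma one_sub_le_gnpProb {n : ℕ} {p : ℝ} (h0 : 0 ≤ p) (h1 : p ≤ 1)
    (A P Q : Set (SimpleGraph (Fin n))) (h : P ∩ Q ⊆ A) :
    1 - (gnpProb n p Pᶜ + gnpProb n p Qᶜ) ≤ gnpProb n p A := by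
  rw [sub_le_iff_le_add', gnpProb_eq_sum_ite, gnpProb_eq_sum_ite, gnpProb_eq_sum_ite,
    ← Finset.sum_add_distrib, ← Finset.sum_add_distrib]
  refine (sum_gnpWeight n p).ge.trans ?_
  refine Finset.sum_le_sum fun G _ => ?_
  have hw := gnpWeight_nonneg h0 h1 G
  have hG := @h G
  simp only [Set.mem_inter_iff, Set.mem_compl_iff] at *
  by_cases hP : G ∈ P <;> by_cases hQ : G ∈ Q <;> by_cases hA : G ∈ A <;> simp_all

lemma gnpProb_le_sum {n : ℕ} {p : ℝ} (h0 : 0 ≤ p) (h1 : p ≤ 1) (A : Set (SimpleGraph (Fin n)))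
    {ι : Type*} (I : Finset ι) (f : ι → SimpleGraph (Fin n) → ℝ)
    (hf : ∀ i ∈ I, ∀ G, 0 ≤ f i G) (hA : ∀ G ∈ A, ∃ i ∈ I, 1 ≤ f i G) :
    gnpProb n p A ≤ ∑ i ∈ I, ∑ G, gnpWeight n p G * f i G := by
  rw [gnpProb_eq_sum_ite, Finset.sum_comm]
  refine Finset.sum_le_sum fun G _ => ?_
  rw [← Finset.mul_sum]
  refine mul_le_mul_of_nonneg_left ?_ (gnpWeight_nonneg h0 h1 G)
  split_ifs with h
  · obtain ⟨i, hi, h1i⟩ := hA G h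
    exact h1i.trans (Finset.single_le_sum (f := fun i => f i G) (fun j hj => hf j hj G) hi)
  · exact Finset.sum_nonneg fun j hj => hf j hj G

section Forest

variable {V : Type*} {G : SimpleGraph V}

/-- The subgraph of `G` on `S` whose edges join each vertex other than `r` to its parent. -/
def parentSubgraph (G : SimpleGraph V) (S : Set V) (r : V) (par : V → V)
    (hpar : ∀ x ∈ S, x ≠ r → G.Adj (par x) x) : G.Subgraph where
  verts := S
  Adj x y := x ∈ S ∧ y ∈ S ∧ ((y ≠ r ∧ par y = x) ∨ (x ≠ r ∧ par x = y))
  adj_sub := by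
    rintro x y ⟨hx, hy, ⟨h, rfl⟩ | ⟨h, rfl⟩⟩
    · exact hpar y hy h
    · exact (hpar x hx h).symm
  edge_vert := fun h => h.1
  symm := ⟨fun x y h => ⟨h.2.1, h.1, h.2.2.symm⟩⟩

/-- A parent map that lowers a level function by one gives a rooted tree whose distances from the
root are the levels. -/
lemma parentSubgraph_isAryTreeOfDepth [Finite V] (S : Set V) (r : V) (par : V → V) (lev : V → ℕ)
    (t d : ℕ) (hpar : ∀ x ∈ S, x ≠ r → G.Adj (par x) x) (hr : r ∈ S) (hr0 : lev r = 0)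
    (hS : ∀ x ∈ S, x ≠ r → par x ∈ S) (hlev : ∀ x ∈ S, x ≠ r → lev x = lev (par x) + 1)
    (hd : ∀ x ∈ S, lev x ≤ d) (hd' : ∃ x ∈ S, lev x = d)
    (ht : ∀ x ∈ S, {y | y ∈ S ∧ y ≠ r ∧ par y = x}.ncard = 0 ∨
      {y | y ∈ S ∧ y ≠ r ∧ par y = x}.ncard = t) :
    IsAryTreeOfDepth (parentSubgraph G S r par hpar) r t d := by
  set T := parentSubgraph G S r par hpar with hT
  have hup : ∀ m (x : T.verts), lev x = m →
      ∃ w : T.coe.Walk ⟨r, hr⟩ x, w.length = m := by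
    intro m
    induction m with
    | zero =>
      rintro ⟨x, hx⟩ h
      have hxr : x = r := by
        by_contra hne
        have := hlev x hx hne
        simp only at h
        omega
      subst hxr
      exact ⟨SimpleGraph.Walk.nil, rfl⟩
    | succ m ih =>
      rintro ⟨x, hx⟩ h
      have hne : x ≠ r := by
        rintro rfl
        simp only at h
        omega
      obtain ⟨w, hw⟩ := ih ⟨par x, hS x hx hne⟩ (by have := hlev x hx hne; simp only at h ⊢; omega)
      have hadj : T.coe.Adj ⟨par x, hS x hx hne⟩ ⟨x, hx⟩ :=
        ⟨hS x hx hne, hx, Or.inl ⟨hne, rfl⟩⟩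
      exact ⟨w.concat hadj, by simp [hw]⟩
  have hlow : ∀ (x y : T.verts) (w : T.coe.Walk x y), lev y ≤ lev x + w.length := by
    intro x y w
    induction w with
    | nil => simp
    | @cons a b c h w ih =>
      have : lev b ≤ lev a + 1 := by
        obtain ⟨ha, hb, ⟨h, h'⟩ | ⟨h, h'⟩⟩ := h
        · have := hlev b hb h
          rw [h'] at this
          omega
        · have := hlev a ha h
          rw [h'] at this
          omega
      simp only [SimpleGraph.Walk.length_cons]
      omega
  have hconn : T.coe.Connected := by
    rw [SimpleGraph.connected_iff_exists_forall_reachable]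
    exact ⟨⟨r, hr⟩, fun x => ⟨(hup _ x rfl).choose⟩⟩
  have hdist : ∀ x : T.verts, T.coe.dist ⟨r, hr⟩ x = lev x := by
    intro x
    obtain ⟨w, hw⟩ := hup _ x rfl
    refine le_antisymm (hw ▸ SimpleGraph.dist_le w) ?_
    obtain ⟨w', hw'⟩ := hconn.exists_walk_length_eq_dist ⟨r, hr⟩ x
    have := hlow _ _ w'
    simp only [hr0] at this
    omega
  refine ⟨hr, ?_, ?_, ?_⟩
  · rw [SimpleGraph.isTree_iff_connected_and_card]
    refine ⟨hconn, le_antisymm ?_ hconn.card_vert_le_card_edgeSet_add_one⟩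
    have hle : Nat.card T.coe.edgeSet ≤ Nat.card {x : T.verts // x ≠ ⟨r, hr⟩} := by
      have hxne : ∀ x : {x : T.verts // x ≠ ⟨r, hr⟩}, x.1.1 ≠ r :=
        fun x h => x.2 (Subtype.ext h)
      refine Nat.card_le_card_of_surjective
        (fun x : {x : T.verts // x ≠ ⟨r, hr⟩} =>
          (⟨s(⟨par x.1.1, hS x.1.1 x.1.2 (hxne x)⟩, x.1), ?_⟩ : T.coe.edgeSet)) ?_
      · rw [SimpleGraph.mem_edgeSet]
        exact ⟨hS x.1.1 x.1.2 (hxne x), x.1.2, Or.inl ⟨hxne x, rfl⟩⟩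
      · rintro ⟨e, he⟩
        induction e with
        | _ a b =>
        rw [SimpleGraph.mem_edgeSet] at he
        obtain ⟨ha, hb, ⟨h, h'⟩ | ⟨h, h'⟩⟩ := he
        · refine ⟨⟨b, fun hh => h (congrArg Subtype.val hh)⟩, ?_⟩
          simp [h']
        · refine ⟨⟨a, fun hh => h (congrArg Subtype.val hh)⟩, ?_⟩
          simp [h', Sym2.eq_swap]
    have hcard : Nat.card {x : T.verts // x ≠ ⟨r, hr⟩} + 1 = Nat.card T.verts := by
      have := Fintype.ofFinite T.verts
      rw [Nat.card_eq_fintype_card, Nat.card_eq_fintype_card, Fintype.card_subtype_compl,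
        Fintype.card_subtype_eq]
      have : 0 < Fintype.card T.verts := Fintype.card_pos_iff.mpr ⟨⟨r, hr⟩⟩
      omega
    omega
  · unfold rootedDepth
    obtain ⟨x, hx, hxd⟩ := hd'
    refine IsGreatest.csSup_eq ⟨⟨⟨x, hx⟩, by rw [hdist, hxd]⟩, ?_⟩
    rintro _ ⟨y, rfl⟩
    rw [hdist]
    exact hd y y.2
  · rintro ⟨x, hx⟩
    have : childCount T.coe ⟨r, hr⟩ ⟨x, hx⟩ = {y | y ∈ S ∧ y ≠ r ∧ par y = x}.ncard := by
      unfold childCount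
      rw [← Set.ncard_image_of_injective _ Subtype.val_injective]
      congr 1
      ext y
      simp only [Set.mem_image, Set.mem_ofPred_eq, hdist]
      constructor
      · rintro ⟨⟨y, hy⟩, ⟨⟨-, -, ⟨h, h'⟩ | ⟨h, h'⟩⟩, hl⟩, rfl⟩
        · exact ⟨hy, h, h'⟩
        · have := hlev x hx h
          simp only at h' hl
          rw [h'] at this
          omega
      · rintro ⟨hy, h, h'⟩
        refine ⟨⟨y, hy⟩, ⟨⟨hx, hy, Or.inl ⟨h, h'⟩⟩, ?_⟩, rfl⟩
        simp only
        rw [hlev y hy h, h']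
    rw [this]
    exact ht x hx

/-- Two disjoint rooted trees in `G` with roots `u` and `v` and depth at most `d`, on the
`Lg`-vertices `X`, in which every vertex has `0` or `t` children. -/
structure AryForest (G : SimpleGraph V) (u v : V) (Lg : V → Prop) (t d : ℕ) where
  /-- The vertices. -/
  X : Finset V
  /-- The parent map, fixing the roots. -/
  par : V → V
  /-- The distance to the root. -/
  lev : V → ℕ
  /-- The root of the tree containing a given vertex. -/
  rt : V → V
  u_mem : u ∈ X
  v_mem : v ∈ X
  lev_u : lev u = 0
  lev_v : lev v = 0
  rt_u : rt u = u
  rt_v : rt v = v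
  eq_of_lev : ∀ x ∈ X, lev x = 0 → x = u ∨ x = v
  par_mem : ∀ x ∈ X, par x ∈ X
  lev_par : ∀ x ∈ X, lev (par x) = lev x - 1
  adj_par : ∀ x ∈ X, lev x ≠ 0 → G.Adj (par x) x
  rt_par : ∀ x ∈ X, rt (par x) = rt x
  lev_le : ∀ x ∈ X, lev x ≤ d
  large : ∀ x ∈ X, Lg x
  card_children : ∀ x ∈ X, (X.filter fun y => lev y ≠ 0 ∧ par y = x).card = 0 ∨
    (X.filter fun y => lev y ≠ 0 ∧ par y = x).card = t

namespace AryForest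

variable {u v : V} {Lg : V → Prop} {t d : ℕ}

/-- The forest consisting of the two roots only. -/
noncomputable def roots (u v : V) (hu : Lg u) (hv : Lg v) : AryForest G u v Lg t d where
  X := {u, v}
  par := id
  lev := fun _ => 0
  rt := id
  u_mem := by simp
  v_mem := by simp
  lev_u := rfl
  lev_v := rfl
  rt_u := rfl
  rt_v := rfl
  eq_of_lev := by simp
  par_mem := by simp
  lev_par := by simp
  adj_par := by simp
  rt_par := by simp
  lev_le := by simp
  large := by
    intro x hx
    rcases Finset.mem_insert.mp hx with rfl | hx
    · exact hu
    · rw [Finset.mem_singleton.mp hx]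
      exact hv
  card_children := by simp

/-- Attach a set `C` of `t` new children to the leaf `x`. -/
lemma exists_extend (T : AryForest G u v Lg t d) {x : V} (hx : x ∈ T.X) (hxd : T.lev x < d)
    (hleaf : (T.X.filter fun y => T.lev y ≠ 0 ∧ T.par y = x).card = 0)
    (C : Finset V) (hC : C.card = t) (hCX : Disjoint C T.X) (hCadj : ∀ y ∈ C, G.Adj x y)
    (hCL : ∀ y ∈ C, Lg y) :
    ∃ T' : AryForest G u v Lg t d, T'.X = T.X ∪ C := by
  have hnC : ∀ y ∈ T.X, y ∉ C := fun y hy hc => Finset.disjoint_left.mp hCX hc hy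
  have hnX : ∀ y ∈ C, y ∉ T.X := fun y hc hy => Finset.disjoint_left.mp hCX hc hy
  refine ⟨{
    X := T.X ∪ C
    par := fun y => if y ∈ C then x else T.par y
    lev := fun y => if y ∈ C then T.lev x + 1 else T.lev y
    rt := fun y => if y ∈ C then T.rt x else T.rt y
    u_mem := Finset.mem_union_left _ T.u_mem
    v_mem := Finset.mem_union_left _ T.v_mem
    lev_u := by simp [hnC u T.u_mem, T.lev_u]
    lev_v := by simp [hnC v T.v_mem, T.lev_v]
    rt_u := by simp [hnC u T.u_mem, T.rt_u]
    rt_v := by simp [hnC v T.v_mem, T.rt_v]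
    eq_of_lev := ?_
    par_mem := ?_
    lev_par := ?_
    adj_par := ?_
    rt_par := ?_
    lev_le := ?_
    large := ?_
    card_children := ?_ }, rfl⟩
  · intro y hy h
    rcases Finset.mem_union.mp hy with hy | hy
    · exact T.eq_of_lev y hy (by simpa [hnC y hy] using h)
    · simp [hy] at h
  · intro y hy
    rcases Finset.mem_union.mp hy with hy | hy
    · simp [hnC y hy, T.par_mem y hy]
    · simp [hy, hx]
  · intro y hy
    rcases Finset.mem_union.mp hy with hy | hy
    · simp [hnC y hy, hnC _ (T.par_mem y hy), T.lev_par y hy]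
    · simp [hy, hnC x hx]
  · intro y hy h
    rcases Finset.mem_union.mp hy with hy | hy
    · simp only [hnC y hy, if_false] at h ⊢
      exact T.adj_par y hy h
    · simp [hy, hCadj y hy]
  · intro y hy
    rcases Finset.mem_union.mp hy with hy | hy
    · simp [hnC y hy, hnC _ (T.par_mem y hy), T.rt_par y hy]
    · simp [hy, hnC x hx]
  · intro y hy
    rcases Finset.mem_union.mp hy with hy | hy
    · simp [hnC y hy, T.lev_le y hy]
    · simpa [hy] using hxd
  · intro y hy
    rcases Finset.mem_union.mp hy with hy | hy
    · exact T.large y hy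
    · exact hCL y hy
  · intro y hy
    have hX : ∀ z, z ∈ T.X.filter (fun w => (if w ∈ C then T.lev x + 1 else T.lev w) ≠ 0 ∧
        (if w ∈ C then x else T.par w) = y) ↔
        z ∈ T.X.filter (fun w => T.lev w ≠ 0 ∧ T.par w = y) := by
      intro z
      simp only [Finset.mem_filter]
      refine and_congr_right fun hz => ?_
      simp [hnC z hz]
    have hX' := Finset.ext hX
    rw [Finset.filter_union, hX']
    by_cases hyx : y = x
    · right
      subst hyx
      rw [Finset.card_eq_zero.mp hleaf, Finset.empty_union]
      refine Eq.trans (congrArg Finset.card ?_) hC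
      refine Finset.filter_true_of_mem fun z hz => ?_
      simp [hz]
    · have : C.filter (fun w => (if w ∈ C then T.lev x + 1 else T.lev w) ≠ 0 ∧
          (if w ∈ C then x else T.par w) = y) = ∅ := by
        refine Finset.filter_false_of_mem fun z hz => ?_
        simp [hz, Ne.symm hyx]
      rw [this, Finset.union_empty]
      rcases Finset.mem_union.mp hy with hy | hy
      · exact T.card_children y hy
      · left
        rw [Finset.card_eq_zero]
        refine Finset.filter_false_of_mem fun z hz => ?_
        rintro ⟨-, h⟩
        exact hnX y hy (h ▸ T.par_mem z hz)

lemma iterate_par_mem (T : AryForest G u v Lg t d) {y : V} (hy : y ∈ T.X) (j : ℕ) :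
    T.par^[j] y ∈ T.X ∧ T.lev (T.par^[j] y) = T.lev y - j := by
  induction j with
  | zero => simpa using hy
  | succ j ih =>
    rw [Function.iterate_succ_apply']
    refine ⟨T.par_mem _ ih.1, ?_⟩
    rw [T.lev_par _ ih.1, ih.2]
    omega

/-- If small vertex sets span few edges, a leaf has few neighbours inside the forest. -/
lemma card_filter_adj_lt (T : AryForest G u v Lg t d) (r : ℕ) (hr : 3 ≤ r)
    (hsparse : ∀ (Y : Finset V) (F : Finset (Sym2 V)), Y.card ≤ r * (d + 1) + 1 →
      (∀ e ∈ F, e ∈ G.edgeSet) → F ⊆ Y.sym2 → F.card < Y.card + (r - 3))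
    {x : V} (hleaf : (T.X.filter fun y => T.lev y ≠ 0 ∧ T.par y = x).card = 0) :
    (T.X.filter fun y => G.Adj x y).card < r := by
  by_contra! hcon
  obtain ⟨R, hR, hRc⟩ := Finset.exists_subset_card_eq hcon
  have hRX : ∀ y ∈ R, y ∈ T.X := fun y hy => (Finset.mem_filter.mp (hR hy)).1
  have hRadj : ∀ y ∈ R, G.Adj x y := fun y hy => (Finset.mem_filter.mp (hR hy)).2
  set Z : Finset V := R.biUnion fun y => (Finset.range (d + 1)).image fun j => T.par^[j] y with hZ
  set Y : Finset V := insert x Z with hY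
  have hYc : Y.card ≤ r * (d + 1) + 1 := by
    refine (Finset.card_insert_le _ _).trans (Nat.succ_le_succ ?_)
    refine (Finset.card_biUnion_le_card_mul _ _ (d + 1) fun y _ => ?_).trans (by rw [hRc])
    exact Finset.card_image_le.trans (by simp)
  have hZX : ∀ z ∈ Z, z ∈ T.X := by
    intro z hz
    simp only [hZ, Finset.mem_biUnion, Finset.mem_image] at hz
    obtain ⟨y, hy, j, -, rfl⟩ := hz
    exact (T.iterate_par_mem (hRX y hy) j).1
  have hRZ : R ⊆ Z := by
    intro y hy
    simp only [hZ, Finset.mem_biUnion, Finset.mem_image]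
    exact ⟨y, hy, 0, by simp, rfl⟩
  have hZpar : ∀ z ∈ Z, T.lev z ≠ 0 → T.par z ∈ Z := by
    intro z hz h0
    simp only [hZ, Finset.mem_biUnion, Finset.mem_image] at hz ⊢
    obtain ⟨y, hy, j, hj, rfl⟩ := hz
    refine ⟨y, hy, j + 1, ?_, Function.iterate_succ_apply' _ _ _⟩
    rw [(T.iterate_par_mem (hRX y hy) j).2] at h0
    have := T.lev_le y (hRX y hy)
    rw [Finset.mem_range]
    omega
  set Y' : Finset V := Y \ {x, u, v} with hY'
  have hY'Z : ∀ z ∈ Y', z ∈ Z ∧ T.lev z ≠ 0 ∧ z ≠ x := by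
    intro z hz
    simp only [hY', hY, Finset.mem_sdiff, Finset.mem_insert, Finset.mem_singleton, not_or] at hz
    have hzZ := hz.1.resolve_left hz.2.1
    refine ⟨hzZ, fun h => ?_, hz.2.1⟩
    rcases T.eq_of_lev z (hZX z hzZ) h with h | h
    · exact hz.2.2.1 h
    · exact hz.2.2.2 h
  have hnopar : ∀ z ∈ T.X, T.lev z ≠ 0 → T.par z ≠ x := by
    intro z hz h0 h
    have : z ∈ (T.X.filter fun y => T.lev y ≠ 0 ∧ T.par y = x) :=
      Finset.mem_filter.mpr ⟨hz, h0, h⟩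
    rw [Finset.card_eq_zero.mp hleaf] at this
    simp at this
  set F₁ := Y'.image fun z => s(T.par z, z) with hF₁
  set F₂ := R.image fun y => s(x, y) with hF₂
  have hc1 : F₁.card = Y'.card := by
    refine Finset.card_image_of_injOn fun a ha b hb hab => ?_
    have ha' := hY'Z a ha
    have hb' := hY'Z b hb
    simp only [Sym2.eq_iff] at hab
    rcases hab with h | h
    · exact h.2
    · exfalso
      have e1 := T.lev_par a (hZX a ha'.1)
      have e2 := T.lev_par b (hZX b hb'.1)
      rw [h.1] at e1
      rw [← h.2] at e2
      have := ha'.2.1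
      have := hb'.2.1
      omega
  have hc2 : F₂.card = r := by
    rw [← hRc]
    refine Finset.card_image_of_injOn fun a ha b hb hab => ?_
    simp only [Sym2.eq_iff] at hab
    rcases hab with h | h
    · exact h.2
    · exact h.2.trans h.1
  have hdis : Disjoint F₁ F₂ := by
    rw [Finset.disjoint_left]
    intro e h1 h2
    simp only [hF₁, hF₂, Finset.mem_image] at h1 h2
    obtain ⟨z, hz, rfl⟩ := h1
    obtain ⟨y, hy, hyz⟩ := h2
    have hz' := hY'Z z hz
    simp only [Sym2.eq_iff] at hyz
    rcases hyz with h | h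
    · exact hnopar z (hZX z hz'.1) hz'.2.1 h.1.symm
    · exact hz'.2.2 h.1.symm
  have hY'c : Y.card ≤ Y'.card + 3 := by
    have h1 : Y.card - ({x, u, v} : Finset V).card ≤ Y'.card := by
      convert Finset.le_card_sdiff ({x, u, v} : Finset V) Y
    have h2 : ({x, u, v} : Finset V).card ≤ 3 := Finset.card_le_three
    omega
  have := hsparse Y (F₁ ∪ F₂) hYc ?_ ?_
  · rw [Finset.card_union_of_disjoint hdis, hc1, hc2] at this
    omega
  · intro e he
    rcases Finset.mem_union.mp he with he | he
    · obtain ⟨z, hz, rfl⟩ := Finset.mem_image.mp he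
      exact T.adj_par z (hZX z (hY'Z z hz).1) (hY'Z z hz).2.1
    · obtain ⟨y, hy, rfl⟩ := Finset.mem_image.mp he
      exact hRadj y hy
  · intro e he
    rcases Finset.mem_union.mp he with he | he
    · obtain ⟨z, hz, rfl⟩ := Finset.mem_image.mp he
      have hz' := hY'Z z hz
      rw [Finset.mk_mem_sym2_iff]
      exact ⟨Finset.mem_insert_of_mem (hZpar z hz'.1 hz'.2.1), Finset.mem_insert_of_mem hz'.1⟩
    · obtain ⟨y, hy, rfl⟩ := Finset.mem_image.mp he
      rw [Finset.mk_mem_sym2_iff]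
      exact ⟨Finset.mem_insert_self _ _, Finset.mem_insert_of_mem (hRZ hy)⟩

/-- A forest in which every vertex above level `d` has children splits into two trees of
depth exactly `d`. -/
lemma exists_subgraphs [Finite V] (T : AryForest G u v Lg t d) (huv : u ≠ v)
    (hfull : ∀ x ∈ T.X, T.lev x < d →
      (T.X.filter fun y => T.lev y ≠ 0 ∧ T.par y = x).card ≠ 0) :
    ∃ Tu Tv : G.Subgraph, Disjoint Tu.verts Tv.verts ∧
      IsAryTreeOfDepth Tu u t d ∧ IsAryTreeOfDepth Tv v t d := by
  have main : ∀ r ∈ T.X, T.lev r = 0 → T.rt r = r →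
      (∀ x ∈ T.X, T.rt x = r → T.lev x = 0 → x = r) →
      ∃ Tr : G.Subgraph, Tr.verts = {x | x ∈ T.X ∧ T.rt x = r} ∧ IsAryTreeOfDepth Tr r t d := by
    intro r hrX hr0 hrr huniq
    have hlev : ∀ x ∈ {x | x ∈ T.X ∧ T.rt x = r}, x ≠ r → T.lev x ≠ 0 :=
      fun x hx hne h => hne (huniq x hx.1 hx.2 h)
    refine ⟨parentSubgraph G {x | x ∈ T.X ∧ T.rt x = r} r T.par
      (fun x hx hne => T.adj_par x hx.1 (hlev x hx hne)), rfl, ?_⟩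
    refine parentSubgraph_isAryTreeOfDepth _ r T.par T.lev t d _ ⟨hrX, hrr⟩ hr0 ?_ ?_ ?_ ?_ ?_
    · intro x hx _
      exact ⟨T.par_mem x hx.1, (T.rt_par x hx.1).trans hx.2⟩
    · intro x hx hne
      have := T.lev_par x hx.1
      have := hlev x hx hne
      omega
    · exact fun x hx => T.lev_le x hx.1
    · have : ∀ m ≤ d, ∃ x ∈ {x | x ∈ T.X ∧ T.rt x = r}, T.lev x = m := by
        intro m
        induction m with
        | zero => exact fun _ => ⟨r, ⟨hrX, hrr⟩, hr0⟩
        | succ m ih =>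
          intro hm
          obtain ⟨x, hx, hxm⟩ := ih (by omega)
          obtain ⟨y, hy⟩ := Finset.card_ne_zero.mp (hfull x hx.1 (by omega))
          rw [Finset.mem_filter] at hy
          refine ⟨y, ⟨hy.1, ?_⟩, ?_⟩
          · rw [← T.rt_par y hy.1, hy.2.2]
            exact hx.2
          · have := T.lev_par y hy.1
            rw [hy.2.2] at this
            have := hy.2.1
            omega
      exact this d le_rfl
    · intro x hx
      have : {y | y ∈ {x | x ∈ T.X ∧ T.rt x = r} ∧ y ≠ r ∧ T.par y = x} =
          ((T.X.filter fun y => T.lev y ≠ 0 ∧ T.par y = x : Finset V) : Set V) := by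
        ext y
        simp only [Set.mem_ofPred_eq, Finset.coe_filter]
        constructor
        · rintro ⟨h1, h2, h3⟩
          exact ⟨h1.1, hlev y h1 h2, h3⟩
        · rintro ⟨h1, h2, h3⟩
          refine ⟨⟨h1, ?_⟩, ?_, h3⟩
          · rw [← T.rt_par y h1, h3]
            exact hx.2
          · rintro rfl
            exact h2 hr0
      rw [this, Set.ncard_coe_finset]
      exact T.card_children x hx.1
  obtain ⟨Tu, hTu, hu⟩ := main u T.u_mem T.lev_u T.rt_u (by
    intro x hx h h0
    rcases T.eq_of_lev x hx h0 with rfl | rfl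
    · rfl
    · exact absurd (h.symm.trans T.rt_v) huv)
  obtain ⟨Tv, hTv, hv⟩ := main v T.v_mem T.lev_v T.rt_v (by
    intro x hx h h0
    rcases T.eq_of_lev x hx h0 with rfl | rfl
    · exact absurd (T.rt_u.symm.trans h) huv
    · rfl)
  refine ⟨Tu, Tv, ?_, hu, hv⟩
  rw [hTu, hTv, Set.disjoint_left]
  rintro x ⟨-, h1⟩ ⟨-, h2⟩
  exact huv (h1.symm.trans h2)

end AryForest

/-- Greedy growth: in a locally sparse graph in which each vertex has at most `s` neighbours that
are not large, any two large vertices are roots of disjoint `t`-ary trees. -/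
lemma exists_disjoint_ary_trees [Fintype V] (Lg : V → Prop) (t d r s : ℕ) (hr : 3 ≤ r) (ht : t ≠ 0)
    (hsparse : ∀ (Y : Finset V) (F : Finset (Sym2 V)), Y.card ≤ r * (d + 1) + 1 →
      (∀ e ∈ F, e ∈ G.edgeSet) → F ⊆ Y.sym2 → F.card < Y.card + (r - 3))
    (hsmall : ∀ x, ((G.neighborFinset x).filter fun y => ¬ Lg y).card ≤ s)
    (hdeg : ∀ x, Lg x → t + r + s ≤ G.degree x) {u v : V} (huv : u ≠ v) (hu : Lg u) (hv : Lg v) :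
    ∃ Tu Tv : G.Subgraph, Disjoint Tu.verts Tv.verts ∧
      IsAryTreeOfDepth Tu u t d ∧ IsAryTreeOfDepth Tv v t d := by
  obtain ⟨m, ⟨T, hTm⟩, hmax⟩ : ∃ m, (∃ T : AryForest G u v Lg t d, T.X.card = m) ∧
      ∀ T' : AryForest G u v Lg t d, T'.X.card ≤ m := by
    have hb : BddAbove (Set.range fun T : AryForest G u v Lg t d => T.X.card) :=
      ⟨Fintype.card V, by rintro _ ⟨T, rfl⟩; exact Finset.card_le_univ _⟩
    have hne : (Set.range fun T : AryForest G u v Lg t d => T.X.card).Nonempty :=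
      ⟨_, AryForest.roots u v hu hv, rfl⟩
    exact ⟨_, Nat.sSup_mem hne hb, fun T' => le_csSup hb ⟨T', rfl⟩⟩
  refine T.exists_subgraphs huv fun x hx hxd hleaf => ?_
  have h1 := T.card_filter_adj_lt r hr hsparse hleaf
  have h2 := hsmall x
  have h3 := hdeg x (T.large x hx)
  have h4 : t ≤ ((G.neighborFinset x).filter fun y => Lg y ∧ y ∉ T.X).card := by
    have hcov : G.neighborFinset x ⊆ ((G.neighborFinset x).filter fun y => Lg y ∧ y ∉ T.X) ∪
        (((G.neighborFinset x).filter fun y => ¬ Lg y) ∪ T.X.filter fun y => G.Adj x y) := by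
      intro y hy
      have hxy : G.Adj x y := by simpa using hy
      simp only [Finset.mem_union, Finset.mem_filter, hy, hxy]
      tauto
    have h5 := Finset.card_le_card hcov
    have h6 := Finset.card_union_le ((G.neighborFinset x).filter fun y => Lg y ∧ y ∉ T.X)
      (((G.neighborFinset x).filter fun y => ¬ Lg y) ∪ T.X.filter fun y => G.Adj x y)
    have h7 := Finset.card_union_le ((G.neighborFinset x).filter fun y => ¬ Lg y)
      (T.X.filter fun y => G.Adj x y)
    rw [SimpleGraph.card_neighborFinset_eq_degree] at h5
    omega
  obtain ⟨C, hC, hCt⟩ := Finset.exists_subset_card_eq h4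
  have hC' : ∀ y ∈ C, G.Adj x y ∧ Lg y ∧ y ∉ T.X := by
    intro y hy
    simpa using hC hy
  have hdisj : Disjoint C T.X := Finset.disjoint_left.mpr fun y hy => (hC' y hy).2.2
  obtain ⟨T', hT'⟩ := T.exists_extend hx hxd hleaf C hCt hdisj
    (fun y hy => (hC' y hy).1) (fun y hy => (hC' y hy).2.1)
  have := hmax T'
  rw [hT', Finset.card_union_of_disjoint hdisj.symm] at this
  omega

end Forest

/-- Every set `Y` of at most `M` vertices spans fewer than `|Y| + c` edges. -/
def IsLocallySparse {V : Type*} (G : SimpleGraph V) (M c : ℕ) : Prop :=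
  ∀ (Y : Finset V) (F : Finset (Sym2 V)), Y.card ≤ M →
    (∀ e ∈ F, e ∈ G.edgeSet) → F ⊆ Y.sym2 → F.card < Y.card + c

lemma choose_mul_choose_mul_pow_le (n m c : ℕ) {p : ℝ} (h0 : 0 ≤ p) :
    (n.choose m : ℝ) * (((m ^ 2).choose (m + c) : ℝ) * p ^ (m + c)) ≤
      (Real.exp 2 * (n * p)) ^ m * (m * p) ^ c := by
  have h1 : (n.choose m : ℝ) ≤ (n : ℝ) ^ m / (m.factorial : ℝ) := Nat.choose_le_pow_div m n
  have h2 : ((m ^ 2).choose (m + c) : ℝ) ≤ ((m ^ 2 : ℕ) : ℝ) ^ (m + c) / ((m + c).factorial : ℝ) :=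
    Nat.choose_le_pow_div (m + c) (m ^ 2)
  have h3 : (m : ℝ) ^ m / (m.factorial : ℝ) ≤ Real.exp m :=
    Real.pow_div_factorial_le_exp m (by positivity) m
  have h4 : (m : ℝ) ^ (m + c) / ((m + c).factorial : ℝ) ≤ Real.exp m :=
    Real.pow_div_factorial_le_exp m (by positivity) (m + c)
  calc (n.choose m : ℝ) * (((m ^ 2).choose (m + c) : ℝ) * p ^ (m + c))
      ≤ ((n : ℝ) ^ m / (m.factorial : ℝ)) *
        (((m ^ 2 : ℕ) : ℝ) ^ (m + c) / ((m + c).factorial : ℝ) * p ^ (m + c)) := by gcongr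
    _ = (n * p) ^ m * (m * p) ^ c * ((m : ℝ) ^ m / (m.factorial : ℝ)) *
        ((m : ℝ) ^ (m + c) / ((m + c).factorial : ℝ)) := by
        push_cast
        ring
    _ ≤ (n * p) ^ m * (m * p) ^ c * Real.exp m * Real.exp m := by gcongr
    _ = (Real.exp 2 * (n * p)) ^ m * (m * p) ^ c := by
        rw [mul_pow (Real.exp 2), ← Real.exp_nat_mul, mul_assoc (_ * _), ← Real.exp_add,
          show (m : ℝ) + m = m * 2 by ring]
        ring

lemma gnpProb_not_isLocallySparse_le {n : ℕ} {p : ℝ} (h0 : 0 ≤ p) (h1 : p ≤ 1) (M c : ℕ)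
    (hnp : 1 ≤ n * p) :
    gnpProb n p {G | IsLocallySparse G M c}ᶜ ≤
      (M + 1) * ((Real.exp 2 * (n * p)) ^ M * (M * p) ^ c) := by
  let I : Finset (Σ _ : ℕ, Σ _ : Finset (Fin n), Finset (Sym2 (Fin n))) :=
    (Finset.range (M + 1)).sigma fun m => (Finset.powersetCard m Finset.univ).sigma fun Y =>
      Finset.powersetCard (m + c) (Y.sym2.filter fun e => ¬ e.IsDiag)
  refine (gnpProb_le_sum h0 h1 _ I (fun i G => if i.2.2 ⊆ G.edgeFinset then 1 else 0)
    (fun i _ G => by split_ifs <;> norm_num) ?_).trans ?_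
  · intro G hG
    simp only [Set.mem_compl_iff, Set.mem_ofPred_eq, IsLocallySparse, not_forall, not_lt] at hG
    obtain ⟨Y, F, hY, hFG, hFY, hF⟩ := hG
    obtain ⟨F', hF', hc⟩ := Finset.exists_subset_card_eq hF
    have hF'G : F' ⊆ G.edgeFinset := fun e he => by
      rw [SimpleGraph.mem_edgeFinset]
      exact hFG e (hF' he)
    refine ⟨⟨Y.card, Y, F'⟩, ?_, by simp only; rw [if_pos hF'G]⟩
    simp only [I, Finset.mem_sigma, Finset.mem_range, Finset.mem_powersetCard]
    refine ⟨by omega, ⟨Finset.subset_univ _, trivial⟩, fun e he => ?_, hc⟩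
    rw [Finset.mem_filter]
    exact ⟨hFY (hF' he), G.not_isDiag_of_mem_edgeSet (hFG e (hF' he))⟩
  · simp only [I]
    rw [Finset.sum_sigma]
    have hm : ∀ m ∈ Finset.range (M + 1),
        ∑ s ∈ (Finset.powersetCard m (Finset.univ : Finset (Fin n))).sigma fun Y =>
          Finset.powersetCard (m + c) (Y.sym2.filter fun e => ¬ e.IsDiag),
          ∑ G : SimpleGraph (Fin n), gnpWeight n p G * (if s.2 ⊆ G.edgeFinset then 1 else 0) ≤
        (Real.exp 2 * (n * p)) ^ M * (M * p) ^ c := by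
      intro m hm
      rw [Finset.sum_sigma]
      have hY : ∀ Y ∈ Finset.powersetCard m (Finset.univ : Finset (Fin n)),
          ∑ F ∈ Finset.powersetCard (m + c) (Y.sym2.filter fun e => ¬ e.IsDiag),
            ∑ G : SimpleGraph (Fin n), gnpWeight n p G * (if F ⊆ G.edgeFinset then 1 else 0) ≤
          ((m ^ 2).choose (m + c) : ℝ) * p ^ (m + c) := by
        intro Y hY
        have hF : ∀ F ∈ Finset.powersetCard (m + c) (Y.sym2.filter fun e => ¬ e.IsDiag),
            ∑ G : SimpleGraph (Fin n), gnpWeight n p G * (if F ⊆ G.edgeFinset then 1 else 0) =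
              p ^ (m + c) := by
          intro F hF
          rw [Finset.mem_powersetCard] at hF
          have := sum_gnpWeight_subset_mul_pow n p 1 F ∅ (fun e he => by
            have := (Finset.mem_filter.mp (hF.1 he)).2
            simpa [SimpleGraph.mem_edgeFinset] using this) (by simp) (by simp)
          rw [hF.2] at this
          simpa using this
        rw [Finset.sum_congr rfl hF, Finset.sum_const, Finset.card_powersetCard, nsmul_eq_mul]
        gcongr
        refine (Finset.card_filter_le _ _).trans ?_
        rw [Finset.card_sym2, (Finset.mem_powersetCard.mp hY).2, Nat.choose_two_right]
        refine Nat.div_le_of_le_mul ?_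
        simp only [Nat.add_sub_cancel]
        nlinarith [Nat.zero_le m, Nat.le_self_pow (two_ne_zero) m]
      refine (Finset.sum_le_sum hY).trans ?_
      rw [Finset.sum_const, Finset.card_powersetCard, nsmul_eq_mul, Finset.card_univ,
        Fintype.card_fin]
      refine (choose_mul_choose_mul_pow_le n m c h0).trans ?_
      have hmM : m ≤ M := by
        have := Finset.mem_range.mp hm
        omega
      have hone : 1 ≤ Real.exp 2 * (n * p) :=
        one_le_mul_of_one_le_of_one_le (Real.one_le_exp (by norm_num)) hnp
      gcongr
    refine (Finset.sum_le_sum hm).trans ?_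
    rw [Finset.sum_const, Finset.card_range, nsmul_eq_mul]
    push_cast
    exact le_rfl

/-- Every vertex has at most two neighbours of degree less than `a`. -/
def HasFewSmallNeighbors {V : Type*} [Fintype V] (G : SimpleGraph V) (a : ℝ) : Prop :=
  ∀ x, ((G.neighborFinset x).filter fun y => ¬ a ≤ (G.degree y : ℝ)).card ≤ 2

lemma card_inter_image_le {n : ℕ} (G : SimpleGraph (Fin n)) (W Z : Finset (Fin n)) :
    (G.edgeFinset ∩ (W ×ˢ Z).image fun q => s(q.1, q.2)).card ≤ ∑ w ∈ W, G.degree w := by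
  have hsub : (G.edgeFinset ∩ (W ×ˢ Z).image fun q => s(q.1, q.2)) ⊆
      W.biUnion fun w => G.incidenceFinset w := by
    intro e he
    rw [Finset.mem_inter, Finset.mem_image] at he
    obtain ⟨he, q, hq, rfl⟩ := he
    rw [Finset.mem_biUnion]
    refine ⟨q.1, (Finset.mem_product.mp hq).1, ?_⟩
    rw [SimpleGraph.mem_incidenceFinset]
    exact ⟨by simpa using he, by simp⟩
  refine (Finset.card_le_card hsub).trans (Finset.card_biUnion_le.trans ?_)
  exact Finset.sum_le_sum fun w _ => (G.card_incidenceFinset_eq_degree w).le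

lemma gnpProb_not_hasFewSmallNeighbors_le {n : ℕ} {p : ℝ} (h0 : 0 ≤ p) (h1 : p ≤ 1) (a : ℝ) :
    gnpProb n p {G | HasFewSmallNeighbors G a}ᶜ ≤
      n * (n ^ 3 * (p ^ 3 * Real.exp (-(3 / 2 * (p * (n - 4)))) * Real.exp (3 * a))) := by
  let F : Fin n → Finset (Fin n) → Finset (Sym2 (Fin n)) := fun x W => W.image fun w => s(x, w)
  let B : Fin n → Finset (Fin n) → Finset (Sym2 (Fin n)) := fun x W =>
    (W ×ˢ (Finset.univ \ insert x W)).image fun q => s(q.1, q.2)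
  let I : Finset (Σ _ : Fin n, Finset (Fin n)) :=
    Finset.univ.sigma fun x => Finset.powersetCard 3 (Finset.univ.erase x)
  refine (gnpProb_le_sum h0 h1 _ I (fun i G => (if F i.1 i.2 ⊆ G.edgeFinset then 1 else 0) *
    Real.exp (-1) ^ (G.edgeFinset ∩ B i.1 i.2).card * Real.exp (3 * a))
    (fun i _ G => by split_ifs <;> positivity) ?_).trans ?_
  · intro G hG
    simp only [Set.mem_compl_iff, Set.mem_ofPred_eq, HasFewSmallNeighbors, not_forall,
      not_le] at hG
    obtain ⟨x, hx⟩ := hG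
    obtain ⟨W, hW, hWc⟩ := Finset.exists_subset_card_eq (Nat.succ_le_of_lt hx)
    have hW' : ∀ w ∈ W, G.Adj x w ∧ (G.degree w : ℝ) < a := by
      intro w hw
      simpa using hW hw
    refine ⟨⟨x, W⟩, ?_, ?_⟩
    · simp only [I, Finset.mem_sigma, Finset.mem_univ, true_and, Finset.mem_powersetCard]
      refine ⟨fun w hw => ?_, hWc⟩
      simpa using (hW' w hw).1.ne'
    · have hF : F x W ⊆ G.edgeFinset := by
        intro e he
        obtain ⟨w, hw, rfl⟩ := Finset.mem_image.mp he
        simpa using (hW' w hw).1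
      simp only [if_pos hF, one_mul]
      rw [← Real.exp_nat_mul, ← Real.exp_add]
      refine Real.one_le_exp ?_
      have h2 : ((G.edgeFinset ∩ B x W).card : ℝ) ≤ ∑ w ∈ W, (G.degree w : ℝ) := by
        exact_mod_cast card_inter_image_le G W _
      have h3 : ∑ w ∈ W, (G.degree w : ℝ) ≤ ∑ _w ∈ W, a :=
        Finset.sum_le_sum fun w hw => (hW' w hw).2.le
      rw [Finset.sum_const, hWc, nsmul_eq_mul] at h3
      push_cast at h3
      linarith
  · simp only [I]
    rw [Finset.sum_sigma]
    have hx : ∀ x ∈ (Finset.univ : Finset (Fin n)),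
        ∑ W ∈ Finset.powersetCard 3 (Finset.univ.erase x),
          ∑ G : SimpleGraph (Fin n), gnpWeight n p G * ((if F x W ⊆ G.edgeFinset then 1 else 0) *
            Real.exp (-1) ^ (G.edgeFinset ∩ B x W).card * Real.exp (3 * a)) ≤
        n ^ 3 * (p ^ 3 * Real.exp (-(3 / 2 * (p * (n - 4)))) * Real.exp (3 * a)) := by
      intro x _
      have hW : ∀ W ∈ Finset.powersetCard 3 (Finset.univ.erase x),
          ∑ G : SimpleGraph (Fin n), gnpWeight n p G * ((if F x W ⊆ G.edgeFinset then 1 else 0) *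
            Real.exp (-1) ^ (G.edgeFinset ∩ B x W).card * Real.exp (3 * a)) ≤
          p ^ 3 * Real.exp (-(3 / 2 * (p * (n - 4)))) * Real.exp (3 * a) := by
        intro W hW
        rw [Finset.mem_powersetCard] at hW
        have hxW : x ∉ W := fun h => by simpa using hW.1 h
        have hFc : (F x W).card = 3 := by
          rw [← hW.2]
          refine Finset.card_image_of_injOn fun a _ b _ hab => ?_
          simp only [Sym2.eq_iff] at hab
          rcases hab with h | h
          · exact h.2
          · exact h.2.trans h.1
        have hBc : (B x W).card = 3 * (n - 4) := by
          rw [Finset.card_image_of_injOn, Finset.card_product, hW.2,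
            Finset.card_sdiff_of_subset (Finset.subset_univ _), Finset.card_insert_of_notMem hxW,
            hW.2, Finset.card_univ, Fintype.card_fin]
          rintro ⟨a, b⟩ hab ⟨a', b'⟩ hab' h
          simp only [Finset.coe_product, Set.mem_prod, Finset.mem_coe, Finset.mem_sdiff,
            Finset.mem_univ, true_and, Finset.mem_insert, not_or, Sym2.eq_iff] at hab hab' h
          rcases h with h | h
          · exact Prod.ext h.1 h.2
          · exact absurd (h.1 ▸ hab.1) hab'.2.2
        have hdis : Disjoint (F x W) (B x W) := by
          rw [Finset.disjoint_left]
          intro e he hb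
          obtain ⟨w, hw, rfl⟩ := Finset.mem_image.mp he
          obtain ⟨q, hq, hqw⟩ := Finset.mem_image.mp hb
          simp only [Finset.mem_product, Finset.mem_sdiff, Finset.mem_univ, true_and,
            Finset.mem_insert, not_or] at hq
          rcases Sym2.eq_iff.mp hqw with h | h
          · exact hxW (h.1 ▸ hq.1)
          · exact hq.2.1 h.2
        have key := sum_gnpWeight_subset_mul_pow n p (Real.exp (-1)) (F x W) (B x W) (by
          intro e he
          obtain ⟨w, hw, rfl⟩ := Finset.mem_image.mp he
          simpa using fun h : x = w => hxW (h ▸ hw)) (by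
          intro e he
          obtain ⟨q, hq, rfl⟩ := Finset.mem_image.mp he
          simp only [Finset.mem_product, Finset.mem_sdiff, Finset.mem_univ, true_and,
            Finset.mem_insert, not_or] at hq
          simpa using fun h : q.1 = q.2 => hq.2.2 (h ▸ hq.1)) hdis
        simp only [← mul_assoc] at key ⊢
        rw [← Finset.sum_mul, key, hFc, hBc]
        have hexp : Real.exp (-1) ≤ 1 / 2 := by
          rw [Real.exp_neg, ← one_div]
          exact one_div_le_one_div_of_le (by norm_num) (by linarith [Real.add_one_le_exp (1 : ℝ)])
        have hbase : 1 - p + Real.exp (-1) * p ≤ Real.exp (-(p / 2)) := by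
          have := Real.add_one_le_exp (-(p / 2))
          nlinarith
        have hbase0 : 0 ≤ 1 - p + Real.exp (-1) * p := by
          have := Real.exp_pos (-1)
          nlinarith
        gcongr
        refine (pow_le_pow_left₀ hbase0 hbase _).trans ?_
        rw [← Real.exp_nat_mul, Real.exp_le_exp]
        have : (n : ℝ) - 4 ≤ ((n - 4 : ℕ) : ℝ) := by
          have : n ≤ n - 4 + 4 := by omega
          rw [sub_le_iff_le_add]
          exact_mod_cast this
        push_cast
        nlinarith
      refine (Finset.sum_le_card_nsmul _ _ _ hW).trans ?_
      rw [nsmul_eq_mul, Finset.card_powersetCard, Finset.card_erase_of_mem (Finset.mem_univ x),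
        Finset.card_univ, Fintype.card_fin]
      gcongr
      have h3 : (n - 1).choose 3 ≤ n ^ 3 :=
        (Nat.choose_le_pow _ _).trans (Nat.pow_le_pow_left (Nat.sub_le _ _) 3)
      exact_mod_cast h3
    refine (Finset.sum_le_card_nsmul _ _ _ hx).trans ?_
    rw [nsmul_eq_mul, Finset.card_univ, Fintype.card_fin]

lemma tendsto_natCast_log_pow_mul_exp (j : ℕ) {b : ℝ} (hb : 0 < b) :
    Tendsto (fun n : ℕ => Real.log n ^ j * Real.exp (-b * Real.log n)) atTop (nhds 0) := by
  have := (tendsto_rpow_mul_exp_neg_mul_atTop_nhds_zero (j : ℝ) b hb).comp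
    (Real.tendsto_log_atTop.comp (tendsto_natCast_atTop_atTop (R := ℝ)))
  simpa [Function.comp_def] using this

/-- Failure probability of local sparsity, with `L = log n` and `l = log log n`. -/
lemma sparse_bound_le {n : ℕ} {p L l : ℝ} {d : ℕ} (hn : Real.exp L = n) (hl : Real.exp l = L)
    (hl200 : 200 ≤ l) (hLl : 1000 * l ≤ L) (hp : 0 ≤ p) (hnp : n * p ≤ 2 * L)
    (hd : (d : ℝ) ≤ 3 / 4 * (L / l)) :
    (((16 * (d + 1) + 1 : ℕ) : ℝ) + 1) * ((Real.exp 2 * (n * p)) ^ (16 * (d + 1) + 1) *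
      (((16 * (d + 1) + 1 : ℕ) : ℝ) * p) ^ 13) ≤
      2 ^ 14 * (L ^ 27 * Real.exp (-(1 / 2) * L)) := by
  have hl0 : 0 < l := by linarith
  have hL0 : 0 < L := by linarith
  set M := 16 * (d + 1) + 1 with hM
  have hn0 : (0 : ℝ) < n := hn ▸ Real.exp_pos L
  have hMl : (M : ℝ) ≤ 12 * (L / l) + 17 := by
    rw [hM]
    push_cast
    linarith
  have hLl' : L / l ≤ L / 200 := by gcongr
  have hML : (M : ℝ) ≤ L - 1 := by linarith
  have hmul : L / l * l = L := by field_simp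
  have hexp : (l + 3) * M ≤ 25 / 2 * L := by
    have : (l + 3) * M ≤ (l + 3) * (12 * (L / l) + 17) := by gcongr
    nlinarith
  have h1 : (Real.exp 2 * (n * p)) ^ M ≤ Real.exp (25 / 2 * L) := by
    have hbase : Real.exp 2 * (n * p) ≤ Real.exp (l + 3) := by
      have h2 : (2 : ℝ) ≤ Real.exp 1 := by linarith [Real.add_one_le_exp (1 : ℝ)]
      calc Real.exp 2 * (n * p) ≤ Real.exp 2 * (Real.exp 1 * L) := by
            refine mul_le_mul_of_nonneg_left (hnp.trans ?_) (Real.exp_pos 2).le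
            exact mul_le_mul_of_nonneg_right h2 hL0.le
        _ = Real.exp (l + 3) := by
            rw [← hl, ← Real.exp_add, ← Real.exp_add]
            congr 1
            ring
    calc (Real.exp 2 * (n * p)) ^ M ≤ Real.exp (l + 3) ^ M := by gcongr
      _ = Real.exp ((l + 3) * M) := by rw [← Real.exp_nat_mul, mul_comm]
      _ ≤ _ := Real.exp_le_exp.mpr hexp
  have h2 : (M * p) ^ 13 ≤ (2 * L ^ 2) ^ 13 * Real.exp (-(13 * L)) := by
    have hbase : M * p ≤ 2 * L ^ 2 * Real.exp (-L) := by
      have hp' : p = n * p * Real.exp (-L) := by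
        rw [Real.exp_neg, hn]
        field_simp
      calc M * p ≤ L * p := by gcongr; linarith
        _ = L * (n * p) * Real.exp (-L) := by rw [mul_assoc L, ← hp']
        _ ≤ L * (2 * L) * Real.exp (-L) := by gcongr
        _ = _ := by ring
    calc (M * p) ^ 13 ≤ (2 * L ^ 2 * Real.exp (-L)) ^ 13 := by gcongr
      _ = _ := by
        rw [mul_pow, ← Real.exp_nat_mul]
        norm_num
  calc ((M : ℝ) + 1) * ((Real.exp 2 * (n * p)) ^ M * (M * p) ^ 13)
      ≤ (2 * L) * (Real.exp (25 / 2 * L) * ((2 * L ^ 2) ^ 13 * Real.exp (-(13 * L)))) := by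
        gcongr
        linarith
    _ = 2 ^ 14 * (L ^ 27 * (Real.exp (25 / 2 * L) * Real.exp (-(13 * L)))) := by ring
    _ = _ := by
        rw [← Real.exp_add]
        congr 3
        ring

/-- Failure probability of the small-neighbour property, with `L = log n`. -/
lemma small_bound_le {n : ℕ} {p L : ℝ} (hn : Real.exp L = n) (hp : 0 ≤ p) (hp1 : p ≤ 1)
    (hnp : n * p ≤ 2 * L) (hnp' : L ≤ n * p) :
    (n : ℝ) * (n ^ 3 * (p ^ 3 * Real.exp (-(3 / 2 * (p * (n - 4)))) *
      Real.exp (3 * (L / 100)))) ≤ 8 * Real.exp 6 * (L ^ 3 * Real.exp (-(47 / 100) * L)) := by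
  have hL0 : 0 ≤ L := by linarith [mul_nonneg (Nat.cast_nonneg (α := ℝ) n) hp]
  calc (n : ℝ) * (n ^ 3 * (p ^ 3 * Real.exp (-(3 / 2 * (p * (n - 4)))) * Real.exp (3 * (L / 100))))
      = (n * p) ^ 3 * (Real.exp L * Real.exp (-(3 / 2 * (p * (n - 4)))) *
          Real.exp (3 * (L / 100))) := by
        rw [hn]
        ring
    _ = (n * p) ^ 3 * Real.exp (L + -(3 / 2 * (p * (n - 4))) + 3 * (L / 100)) := by
        rw [Real.exp_add, Real.exp_add]
    _ ≤ (2 * L) ^ 3 * Real.exp (6 + -(47 / 100) * L) := by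
        refine mul_le_mul (by gcongr) (Real.exp_le_exp.mpr ?_) (Real.exp_pos _).le (by positivity)
        linarith
    _ = _ := by
        rw [Real.exp_add]
        ring

/-- Almost surely, for every pair of large vertices `u, v` of `G(n, p(n))` there are
vertex-disjoint `⌊log n/101⌋`-ary trees `T_u, T_v ⊆ G` rooted at `u` and `v`,
each of depth `⌊(3/4 − ε)·D⌋`, where `D = log n / log log n` and `ε = 1/log log n`. -/
theorem disjoint_ary_trees_as (k : ℕ) (hk : 1 ≤ k) :
    Tendsto (fun n : ℕ =>
      gnpProb n ((Real.log n + ((k : ℝ) + 1) * Real.log (Real.log n) -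
          Real.log (Real.log (Real.log n))) / n)
        {G : SimpleGraph (Fin n) | ∀ u v : Fin n, u ≠ v →
          Real.log n / 100 ≤ (G.degree u : ℝ) → Real.log n / 100 ≤ (G.degree v : ℝ) →
          ∃ Tu Tv : G.Subgraph,
            Disjoint Tu.verts Tv.verts ∧
            IsAryTreeOfDepth Tu u ⌊Real.log n / 101⌋₊
              ⌊(3 / 4 - 1 / Real.log (Real.log n)) *
                (Real.log n / Real.log (Real.log n))⌋₊ ∧
            IsAryTreeOfDepth Tv v ⌊Real.log n / 101⌋₊
              ⌊(3 / 4 - 1 / Real.log (Real.log n)) *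
                (Real.log n / Real.log (Real.log n))⌋₊})
      atTop (nhds 1) := by
  set p : ℕ → ℝ := fun n => (Real.log n + ((k : ℝ) + 1) * Real.log (Real.log n) -
    Real.log (Real.log (Real.log n))) / n with hp
  have hL : Tendsto (fun n : ℕ => Real.log n) atTop atTop :=
    Real.tendsto_log_atTop.comp tendsto_natCast_atTop_atTop
  have hl : Tendsto (fun n : ℕ => Real.log (Real.log n)) atTop atTop :=
    Real.tendsto_log_atTop.comp hL
  have hlL : ∀ C : ℝ, 0 < C → ∀ᶠ n : ℕ in atTop, C * Real.log (Real.log n) ≤ Real.log n := by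
    intro C hC
    have h := hL.eventually (Real.isLittleO_log_id_atTop.bound (inv_pos.mpr hC))
    filter_upwards [h, hL.eventually_ge_atTop 1, hl.eventually_ge_atTop 0] with n h h1 h2
    rw [id, Real.norm_of_nonneg h2, Real.norm_of_nonneg (by linarith)] at h
    rwa [← le_inv_mul_iff₀ hC]
  have hLn : ∀ᶠ n : ℕ in atTop, 2 * Real.log n ≤ n := by
    have h := (tendsto_natCast_atTop_atTop (R := ℝ)).eventually
      (Real.isLittleO_log_id_atTop.bound (show (0 : ℝ) < 1 / 2 by norm_num))
    filter_upwards [h, hL.eventually_ge_atTop 1] with n h h1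
    rw [id, Real.norm_of_nonneg (by linarith), Real.norm_of_nonneg (by positivity)] at h
    linarith
  have hlim : Tendsto (fun n : ℕ => 1 - (2 ^ 14 * (Real.log n ^ 27 *
      Real.exp (-(1 / 2) * Real.log n)) + 8 * Real.exp 6 * (Real.log n ^ 3 *
      Real.exp (-(47 / 100) * Real.log n)))) atTop (nhds 1) := by
    have h1 := (tendsto_natCast_log_pow_mul_exp 27 (b := 1 / 2) (by norm_num)).const_mul
      ((2 : ℝ) ^ 14)
    have h2 := (tendsto_natCast_log_pow_mul_exp 3 (b := 47 / 100) (by norm_num)).const_mul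
      (8 * Real.exp 6)
    have := (h1.add h2).const_sub 1
    simpa only [mul_zero, add_zero, sub_zero] using this
  have hbounds : ∀ᶠ n : ℕ in atTop, 0 ≤ p n ∧ p n ≤ 1 ∧ Real.log n ≤ n * p n ∧
      n * p n ≤ 2 * Real.log n := by
    filter_upwards [hL.eventually_ge_atTop 1, hl.eventually_ge_atTop 1,
      hlL ((k : ℝ) + 1) (by positivity), hLn] with n h1 h2 h3 h4
    have hn0 : (0 : ℝ) < n := by linarith
    have hnp : n * p n = Real.log n + ((k : ℝ) + 1) * Real.log (Real.log n) -
        Real.log (Real.log (Real.log n)) := by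
      rw [hp]
      field_simp
    have h5 : 0 ≤ Real.log (Real.log (Real.log n)) := Real.log_nonneg h2
    have h6 : Real.log (Real.log (Real.log n)) ≤ Real.log (Real.log n) := by
      linarith [Real.log_le_sub_one_of_pos (show 0 < Real.log (Real.log n) by linarith)]
    have h7 : 0 ≤ (k : ℝ) * Real.log (Real.log n) := by positivity
    have hlow : Real.log n ≤ n * p n := by
      rw [hnp]
      linarith
    have hup : n * p n ≤ 2 * Real.log n := by
      rw [hnp]
      linarith
    refine ⟨?_, ?_, hlow, hup⟩
    · exact (pos_of_mul_pos_right (lt_of_lt_of_le (by linarith) hlow) hn0.le).le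
    · refine le_of_mul_le_mul_left ?_ hn0
      linarith
  refine tendsto_of_tendsto_of_tendsto_of_le_of_le' hlim tendsto_const_nhds ?_ ?_
  · filter_upwards [hbounds, hL.eventually_ge_atTop 200000, hl.eventually_ge_atTop 200,
      hlL 1000 (by norm_num), eventually_gt_atTop 0] with n ⟨h0, h1, hlow, hup⟩ hL1 hl1 hlL1 hn
    have hn0 : (0 : ℝ) < n := Nat.cast_pos.mpr hn
    have hexpL : Real.exp (Real.log n) = n := Real.exp_log hn0
    have hexpl : Real.exp (Real.log (Real.log n)) = Real.log n := Real.exp_log (by linarith)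
    set L := Real.log n
    set l := Real.log L
    set d := ⌊(3 / 4 - 1 / l) * (L / l)⌋₊
    have hd : (d : ℝ) ≤ 3 / 4 * (L / l) := by
      have hLl : 0 ≤ L / l := by positivity
      have hl' : 0 ≤ 1 / l := by positivity
      have hle : (3 / 4 - 1 / l) * (L / l) ≤ 3 / 4 * (L / l) :=
        mul_le_mul_of_nonneg_right (by linarith) hLl
      exact (Nat.cast_le.mpr (Nat.floor_le_floor hle)).trans (Nat.floor_le (by positivity))
    have hA := gnpProb_not_isLocallySparse_le h0 h1 (16 * (d + 1) + 1) 13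
      (show 1 ≤ (n : ℝ) * p n by linarith)
    have hB := gnpProb_not_hasFewSmallNeighbors_le (n := n) h0 h1 (L / 100)
    have hA' := hA.trans (sparse_bound_le hexpL hexpl hl1 hlL1 h0 hup hd)
    have hB' := hB.trans (small_bound_le hexpL h0 h1 hup hlow)
    refine le_trans ?_ (one_sub_le_gnpProb h0 h1 _ {G | IsLocallySparse G (16 * (d + 1) + 1) 13}
      {G | HasFewSmallNeighbors G (L / 100)} ?_)
    · linarith
    · rintro G ⟨hG1, hG2⟩ u v huv hu hv
      refine exists_disjoint_ary_trees (fun x => L / 100 ≤ (G.degree x : ℝ)) _ d 16 2 (by norm_num)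
        ?_ hG1 hG2 ?_ huv hu hv
      · exact (Nat.floor_pos.mpr (by linarith)).ne'
      · intro x hx
        have ht : ((⌊L / 101⌋₊ : ℕ) : ℝ) ≤ L / 101 := Nat.floor_le (by positivity)
        have : ((⌊L / 101⌋₊ + 16 + 2 : ℕ) : ℝ) ≤ (G.degree x : ℝ) := by
          push_cast
          linarith
        exact_mod_cast this
  · filter_upwards [hbounds] with n ⟨h0, h1, _, _⟩
    exact gnpProb_le_one h0 h1 _
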